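/- arXiv:1007.3150 — 3 statements merged into one kernel-verified Lean document; each statement's English description precedes it below -/
import Mathlib

section
/- For each pair of distinct indices a, b ∈ {1,2,3,4} let n_ab = n_ba ∈ ℝ³ be a unit vector and k_ab = k_ba > 0 a positive real. Assume the closure conditions: for each a, ∑_{b > a} k_ab • n_ab − ∑_{b < a} k_ba • n_ba = 0. Assume non-degeneracy: the six vectors {n_ab}_{a<b} span ℝ³, and for each a the three vectors {n_ab}_{b ≠ a} span a two-dimensional subspace of ℝ³. Then for any D : Fin 4 → ℝ³, the following are equivalent: (i) for all a < b, D_a − D_b lies in the line ℝ • n_ab (i.e. D_a − D_b = 0 in the plane orthogonal to n_ab); (ii) there exists C ∈ ℝ³ with D_a = C for all a. -/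
/-- Constraints along the edges of the oriented complete graph on four vertices: if the edge
vectors form a generic flow, expressed through three independent vectors `x`, `y`, `z`, then a
potential whose differences are parallel to the edge vectors is constant. -/
theorem potential_eq_of_sub_parallel {V : Type*} [AddCommGroup V] [Module ℝ V] {x y z : V}
    (hli : LinearIndependent ℝ ![x, y, z]) (D : Fin 4 → V) {p q r s t : ℝ}
    (h01 : D 0 - D 1 = p • (x + y)) (h02 : D 0 - D 2 = q • (z - x))
    (h03 : D 0 - D 3 = r • (y + z)) (h12 : D 1 - D 2 = s • x) (h13 : D 1 - D 3 = t • y) :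
    ∀ a, D a = D 0 := by
  have hzero : ∀ u v w : ℝ, u • x + v • y + w • z = 0 → u = 0 ∧ v = 0 ∧ w = 0 := by
    intro u v w h
    have key := Fintype.linearIndependent_iff.mp hli ![u, v, w]
      (by simpa [Fin.sum_univ_three] using h)
    exact ⟨key 0, key 1, key 2⟩
  have h012 : (p + s + q) • x + p • y + (-q) • z = 0 := by
    have h : p • (x + y) + s • x - q • (z - x) = 0 := by rw [← h01, ← h02, ← h12]; abel
    rw [← h]; module
  have h013 : p • x + (p + t - r) • y + (-r) • z = 0 := by
    have h : p • (x + y) + t • y - r • (y + z) = 0 := by rw [← h01, ← h03, ← h13]; abel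
    rw [← h]; module
  obtain ⟨-, hp, hq⟩ := hzero _ _ _ h012
  obtain ⟨-, -, hr⟩ := hzero _ _ _ h013
  rw [hp, zero_smul, sub_eq_zero] at h01
  rw [neg_eq_zero.mp hq, zero_smul, sub_eq_zero] at h02
  rw [neg_eq_zero.mp hr, zero_smul, sub_eq_zero] at h03
  intro a
  fin_cases a
  exacts [rfl, h01.symm, h02.symm, h03.symm]


/-- For the self-energy graph, under the closure conditions and non-degeneracy,
the constraints "`D_a − D_b` is parallel to `n_ab` for all `a < b`" are equivalent
to all `D_a` being equal to a single vector `C ∈ ℝ³`. -/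
theorem self_energy_constraint_rank
    (n : Fin 4 → Fin 4 → EuclideanSpace ℝ (Fin 3)) (k : Fin 4 → Fin 4 → ℝ)
    (hnsymm : ∀ a b, n a b = n b a) (hksymm : ∀ a b, k a b = k b a)
    (hnunit : ∀ a b, a ≠ b → ‖n a b‖ = 1) (hkpos : ∀ a b, a ≠ b → 0 < k a b)
    (hclosure : ∀ a : Fin 4,
      (∑ b ∈ Finset.univ.filter (fun b => a < b), k a b • n a b)
        - (∑ b ∈ Finset.univ.filter (fun b => b < a), k b a • n b a) = 0)
    (hspan : Submodule.span ℝ {x | ∃ a b : Fin 4, a < b ∧ x = n a b} = ⊤)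
    (hplane : ∀ a : Fin 4,
      Module.finrank ℝ (Submodule.span ℝ {x | ∃ b : Fin 4, b ≠ a ∧ x = n a b}) = 2)
    (D : Fin 4 → EuclideanSpace ℝ (Fin 3)) :
    (∀ a b : Fin 4, a < b → ∃ r : ℝ, D a - D b = r • n a b) ↔
      (∃ C : EuclideanSpace ℝ (Fin 3), ∀ a, D a = C) := by
  constructor
  swap
  · rintro ⟨C, hC⟩ a b -
    exact ⟨0, by simp [hC]⟩
  intro h
  set x := k 1 2 • n 1 2 with hx
  set y := k 1 3 • n 1 3 with hy
  set z := k 2 3 • n 2 3 with hz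
  have c1 : x + y - k 0 1 • n 0 1 = 0 := by
    simpa [Finset.sum_filter, Fin.sum_univ_four, ← hx, ← hy] using hclosure 1
  have c2 : z - (k 0 2 • n 0 2 + x) = 0 := by
    simpa [Finset.sum_filter, Fin.sum_univ_four, ← hx, ← hz] using hclosure 2
  have c3 : -(k 0 3 • n 0 3 + y + z) = 0 := by
    simpa [Finset.sum_filter, Fin.sum_univ_four, ← hy, ← hz] using hclosure 3
  have e01 : k 0 1 • n 0 1 = x + y := (sub_eq_zero.mp c1).symm
  have e02 : k 0 2 • n 0 2 = z - x := eq_sub_of_add_eq (sub_eq_zero.mp c2).symm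
  have e03 : k 0 3 • n 0 3 = -(y + z) :=
    eq_neg_of_add_eq_zero_left ((add_assoc _ _ _).symm.trans (neg_eq_zero.mp c3))
  have hk : ∀ a b, a < b → k a b ≠ 0 := fun a b hab => (hkpos a b hab.ne).ne'
  have hpar : ∀ a b, a < b → ∃ r : ℝ, D a - D b = r • (k a b • n a b) := by
    intro a b hab
    obtain ⟨r, hr⟩ := h a b hab
    exact ⟨r / k a b, by rw [hr, smul_smul, div_mul_cancel₀ _ (hk a b hab)]⟩
  have htop : ⊤ ≤ Submodule.span ℝ (Set.range ![x, y, z]) := by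
    have mem : ∀ i, ![x, y, z] i ∈ Submodule.span ℝ (Set.range ![x, y, z]) :=
      fun i => Submodule.subset_span ⟨i, rfl⟩
    have mx : x ∈ Submodule.span ℝ (Set.range ![x, y, z]) := mem 0
    have my : y ∈ Submodule.span ℝ (Set.range ![x, y, z]) := mem 1
    have mz : z ∈ Submodule.span ℝ (Set.range ![x, y, z]) := mem 2
    rw [← hspan, Submodule.span_le]
    rintro _ ⟨a, b, hab, rfl⟩
    rw [SetLike.mem_coe, ← Submodule.smul_mem_iff _ (hk a b hab)]
    fin_cases a <;> fin_cases b <;> first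
      | exact absurd hab (by decide)
      | exact mx
      | exact my
      | exact mz
      | exact e01 ▸ add_mem mx my
      | exact e02 ▸ sub_mem mz mx
      | exact e03 ▸ neg_mem (add_mem my mz)
  have hli : LinearIndependent ℝ ![x, y, z] :=
    linearIndependent_of_top_le_span_of_card_eq_finrank htop (by simp)
  obtain ⟨p, hp⟩ := hpar 0 1 (by decide)
  obtain ⟨q, hq⟩ := hpar 0 2 (by decide)
  obtain ⟨r, hr⟩ := hpar 0 3 (by decide)
  obtain ⟨s, hs⟩ := hpar 1 2 (by decide)
  obtain ⟨t, ht⟩ := hpar 1 3 (by decide)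
  rw [e01] at hp
  rw [e02] at hq
  rw [e03, smul_neg, ← neg_smul] at hr
  exact ⟨D 0, potential_eq_of_sub_parallel hli D hp hq hr hs ht⟩
end

section
/- For all natural numbers a, b, c the following identity holds in ℝ (with factorials cast to ℝ and √ the real square root): √(a! · b! / (a+b+1)!) · √(a! · (b+c)! / (a+b+c+1)!) · √(c! · (a+b)! / (a+b+c+1)!) · √(b! · c! / (b+c+1)!) · ( (a+b+c+1)! / (a! · b! · c!) ) = 1 / √((a+b+1) · (b+c+1)). -/
/-- Closed-form evaluation of the maximally degenerate `6j` symbol: the product of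
the four `Δ` factors with `(k+1)!/F(k)` at the single term `k = a+b+c` equals
`1/√((a+b+1)(b+c+1))`, where `a = 2j₁₂`, `b = 2j₂₃`, `c = 2j₃₄`. -/
theorem degenerate_6j_evaluation (a b c : ℕ) :
    Real.sqrt ((a.factorial : ℝ) * (b.factorial : ℝ) / ((a + b + 1).factorial : ℝ)) *
    Real.sqrt ((a.factorial : ℝ) * ((b + c).factorial : ℝ) / ((a + b + c + 1).factorial : ℝ)) *
    Real.sqrt ((c.factorial : ℝ) * ((a + b).factorial : ℝ) / ((a + b + c + 1).factorial : ℝ)) *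
    Real.sqrt ((b.factorial : ℝ) * (c.factorial : ℝ) / ((b + c + 1).factorial : ℝ)) *
    (((a + b + c + 1).factorial : ℝ) / ((a.factorial : ℝ) * (b.factorial : ℝ) * (c.factorial : ℝ)))
      = 1 / Real.sqrt (((a : ℝ) + b + 1) * ((b : ℝ) + c + 1)) := by
  have ha : (0 : ℝ) < a.factorial := by positivity
  have hb : (0 : ℝ) < b.factorial := by positivity
  have hc : (0 : ℝ) < c.factorial := by positivity
  have hab : (0 : ℝ) < (a + b).factorial := by positivity
  have hbc : (0 : ℝ) < (b + c).factorial := by positivity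
  have hN : (0 : ℝ) < (a + b + c + 1).factorial := by positivity
  rw [Nat.factorial_succ (a + b), Nat.factorial_succ (b + c)]
  push_cast
  generalize (a.factorial : ℝ) = A at *
  generalize (b.factorial : ℝ) = B at *
  generalize (c.factorial : ℝ) = C at *
  generalize ((a + b).factorial : ℝ) = P at *
  generalize ((b + c).factorial : ℝ) = Q at *
  generalize ((a + b + c + 1).factorial : ℝ) = N at *
  have hx : (0 : ℝ) < (a : ℝ) + b + 1 := by positivity
  have hy : (0 : ℝ) < (b : ℝ) + c + 1 := by positivity
  generalize (a : ℝ) + b + 1 = x at *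
  generalize (b : ℝ) + c + 1 = y at *
  rw [← Real.sqrt_mul (by positivity), ← Real.sqrt_mul (by positivity),
    ← Real.sqrt_mul (by positivity)]
  have key : A * B / (x * P) * (A * Q / N) * (C * P / N) * (B * C / (y * Q)) =
      (A * B * C / N) ^ 2 / (x * y) := by
    field_simp
  rw [key, Real.sqrt_div (by positivity), Real.sqrt_sq (by positivity)]
  have hs : 0 < Real.sqrt (x * y) := Real.sqrt_pos.2 (by positivity)
  field_simp
end

section
/- For all natural numbers p₁, m₁, p₂, m₂, setting P = p₁ + p₂ and M = m₁ + m₂, the following identity holds in ℝ (with factorials cast to ℝ and √ the real square root): √((p₁+m₁+1) · (p₂+m₂+1) · (P+M+1)) · √( (p₁! · m₁! · p₂! · m₂! · (P+M+1)!) / ((p₁+m₁+1)! · (p₂+m₂+1)! · (P+1)! · (M+1)!) ) · √( (P! · M! · (p₂+m₂)! · (p₁+m₁)!) / ((P+M+1)! · p₂! · p₁! · m₂! · m₁!) ) = √( (P+M+1) / ((P+1) · (M+1)) ). -/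
/-- Simplification of the EPRL fusion coefficient in the maximally degenerate case
`j₃ = j₁ + j₂`, written with `p_a = 2j_a⁺`, `m_a = 2j_a⁻`, `P = p₁ + p₂`, `M = m₁ + m₂`. -/
theorem degenerate_fusion_coefficient (p₁ m₁ p₂ m₂ : ℕ) :
    Real.sqrt ((((p₁ + m₁ + 1 : ℕ) : ℝ)) * (((p₂ + m₂ + 1 : ℕ) : ℝ)) *
        (((p₁ + p₂ + m₁ + m₂ + 1 : ℕ) : ℝ))) *
    Real.sqrt (((p₁.factorial : ℝ) * (m₁.factorial : ℝ) * (p₂.factorial : ℝ) *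
        (m₂.factorial : ℝ) * (((p₁ + p₂) + (m₁ + m₂) + 1).factorial : ℝ)) /
      (((p₁ + m₁ + 1).factorial : ℝ) * ((p₂ + m₂ + 1).factorial : ℝ) *
        (((p₁ + p₂) + 1).factorial : ℝ) * (((m₁ + m₂) + 1).factorial : ℝ))) *
    Real.sqrt ((((p₁ + p₂).factorial : ℝ) * ((m₁ + m₂).factorial : ℝ) *
        ((p₂ + m₂).factorial : ℝ) * ((p₁ + m₁).factorial : ℝ)) /
      ((((p₁ + p₂) + (m₁ + m₂) + 1).factorial : ℝ) * (p₂.factorial : ℝ) *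
        (p₁.factorial : ℝ) * (m₂.factorial : ℝ) * (m₁.factorial : ℝ)))
      = Real.sqrt ((((p₁ + p₂) + (m₁ + m₂) + 1 : ℕ) : ℝ) /
          ((((p₁ + p₂) + 1 : ℕ) : ℝ) * (((m₁ + m₂) + 1 : ℕ) : ℝ))) := by
  rw [← Real.sqrt_mul (by positivity), ← Real.sqrt_mul (by positivity)]
  congr 1
  have hN := Nat.cast_ne_zero (R := ℝ).mpr ((p₁ + p₂) + (m₁ + m₂) + 1).factorial_ne_zero
  generalize ((((p₁ + p₂) + (m₁ + m₂) + 1).factorial : ℕ) : ℝ) = N at hN ⊢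
  rw [Nat.factorial_succ (p₁ + m₁), Nat.factorial_succ (p₂ + m₂),
    Nat.factorial_succ (p₁ + p₂), Nat.factorial_succ (m₁ + m₂)]
  push_cast
  field_simp
  ring
end
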